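/- Let μ, ν ∈ P₁((0,∞)) and π ∈ M(μ,ν) with disintegration π(dx₀,dx₁) = μ(dx₀) π_{x₀}(dx₁). Then the disintegration of S(π) over its first marginal S(μ) satisfies (S(π))_{y₀} = S(π_{1/y₀}) for S(μ)-almost every y₀; equivalently, S(π)(dy₀,dy₁) = S(μ)(dy₀) S(π_{1/y₀})(dy₁). -/

import Mathlib

open MeasureTheory Set

/-- Barycenter of a measure on `ℝ`. -/
noncomputable def bary (mu : Measure ℝ) : ℝ := ∫ x, x ∂mu

/-- `mu ∈ P₁((0,∞))`: Borel probability measure on `ℝ` concentrated on `(0,∞)`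
with finite first moment. -/
def MemP1 (mu : Measure ℝ) : Prop :=
  IsProbabilityMeasure mu ∧ mu (Set.Ioi (0:ℝ))ᶜ = 0 ∧ Integrable id mu

/-- Change-of-numeraire transform of a measure on `ℝ`:
`S(mu)(B) = (1/b(mu)) ∫ x · 1_B(1/x) dmu(x)`. -/
noncomputable def S (mu : Measure ℝ) : Measure ℝ :=
  (ENNReal.ofReal (bary mu))⁻¹ •
    ((mu.withDensity fun x => ENNReal.ofReal x).map fun x => x⁻¹)

/-- Change-of-numeraire transform of a measure on `ℝ × ℝ`:
`S(π)(B) = (∫ x₁ · 1_B(1/x₀,1/x₁) dπ) / (∫ x₁ dπ)`. -/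
noncomputable def S2 (pi : Measure (ℝ × ℝ)) : Measure (ℝ × ℝ) :=
  (ENNReal.ofReal (∫ p, p.2 ∂pi))⁻¹ •
    ((pi.withDensity fun p => ENNReal.ofReal p.2).map fun p => (p.1⁻¹, p.2⁻¹))

/-- `π ∈ M(μ,ν)`: martingale coupling of `μ` and `ν`, i.e. a probability measure on
`(0,∞)²` with first marginal `μ`, second marginal `ν`, such that
`∫ f(x₀)(x₁ - x₀) dπ = 0` for all bounded Borel `f`. -/
def IsMC (mu nu : Measure ℝ) (pi : Measure (ℝ × ℝ)) : Prop :=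
  IsProbabilityMeasure pi ∧
  pi ((Set.Ioi (0:ℝ) ×ˢ Set.Ioi (0:ℝ))ᶜ) = 0 ∧
  pi.map Prod.fst = mu ∧ pi.map Prod.snd = nu ∧
  ∀ f : ℝ → ℝ, Measurable f → (∃ M, ∀ x, |f x| ≤ M) →
    ∫ p, f p.1 * (p.2 - p.1) ∂pi = 0

open scoped Classical in
/-- Disintegration (conditional kernel) of a measure on a product space with respect to the
first coordinate; equal to `Measure.condKernel` for finite measures. -/
noncomputable def disint {α β : Type*} [MeasurableSpace α] [MeasurableSpace β]
    [StandardBorelSpace β] [Nonempty β] (rho : Measure (α × β)) : α → Measure β :=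
  if h : IsFiniteMeasure rho then (letI := h; fun a => rho.condKernel a)
  else fun _ => 0

open ProbabilityTheory
open scoped ENNReal

lemma lintegral_S (mu : Measure ℝ) {g : ℝ → ℝ≥0∞} (hg : Measurable g) :
    ∫⁻ y, g y ∂(S mu) =
      (ENNReal.ofReal (bary mu))⁻¹ * ∫⁻ x, ENNReal.ofReal x * g x⁻¹ ∂mu := by
  rw [S, lintegral_smul_measure, lintegral_map hg measurable_inv,
    lintegral_withDensity_eq_lintegral_mul _ (by fun_prop) (by fun_prop)]
  rfl

lemma lintegral_S2 (pi : Measure (ℝ × ℝ)) {g : ℝ × ℝ → ℝ≥0∞} (hg : Measurable g) :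
    ∫⁻ q, g q ∂(S2 pi) =
      (ENNReal.ofReal (∫ p, p.2 ∂pi))⁻¹ *
        ∫⁻ p, ENNReal.ofReal p.2 * g (p.1⁻¹, p.2⁻¹) ∂pi := by
  have hm : Measurable fun p : ℝ × ℝ => (p.1⁻¹, p.2⁻¹) := by fun_prop
  rw [S2, lintegral_smul_measure, lintegral_map hg hm,
    lintegral_withDensity_eq_lintegral_mul _ (by fun_prop) (by fun_prop)]
  rfl

lemma ae_S_of_ae_inv {mu : Measure ℝ} {P : ℝ → Prop} (h : ∀ᵐ x ∂mu, P x⁻¹) :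
    ∀ᵐ y ∂(S mu), P y := by
  refine Measure.ae_smul_measure ?_ _
  have hinv : MeasurableEmbedding fun x : ℝ => x⁻¹ :=
    (MeasurableEquiv.inv ℝ).measurableEmbedding
  exact hinv.ae_map_iff.2 ((withDensity_absolutelyContinuous _ _).ae_le h)

lemma MemP1.ae_pos {mu : Measure ℝ} (h : MemP1 mu) : ∀ᵐ x ∂mu, 0 < x :=
  h.2.1

lemma MemP1.ofReal_bary {mu : Measure ℝ} (h : MemP1 mu) :
    ENNReal.ofReal (bary mu) = ∫⁻ x, ENNReal.ofReal x ∂mu :=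
  ofReal_integral_eq_lintegral_ofReal h.2.2 (h.ae_pos.mono fun _ hx => hx.le)

lemma MemP1.bary_pos {mu : Measure ℝ} (h : MemP1 mu) : 0 < bary mu := by
  have := h.1
  refine (integral_pos_iff_support_of_nonneg_ae (h.ae_pos.mono fun _ hx => hx.le) h.2.2).2 ?_
  have hs : ∀ᵐ x ∂mu, x ∈ Function.support fun x : ℝ => x :=
    h.ae_pos.mono fun _ hx => hx.ne'
  have h1 := (measure_congr (Filter.eventuallyEq_univ.2 hs)).trans measure_univ
  exact one_pos.trans_eq h1.symm

lemma MemP1.isProbabilityMeasure_S {mu : Measure ℝ} (h : MemP1 mu) :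
    IsProbabilityMeasure (S mu) := by
  refine ⟨?_⟩
  have := lintegral_S mu (g := fun _ => 1) measurable_const
  simp only [lintegral_one, mul_one] at this
  rw [this, ← h.ofReal_bary]
  exact ENNReal.inv_mul_cancel (by simpa using h.bary_pos) ENNReal.ofReal_ne_top

namespace IsMC

variable {mu nu : Measure ℝ} {pi : Measure (ℝ × ℝ)}

lemma fst_eq (hpi : IsMC mu nu pi) : pi.fst = mu := hpi.2.2.1

lemma ae_pos (hpi : IsMC mu nu pi) : ∀ᵐ p ∂pi, 0 < p.1 ∧ 0 < p.2 := hpi.2.1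

lemma integrable_fst (hmu : MemP1 mu) (hpi : IsMC mu nu pi) :
    Integrable (fun p : ℝ × ℝ => p.1) pi := by
  have h := hmu.2.2
  rw [← hpi.2.2.1] at h
  exact h.comp_measurable measurable_fst

lemma integrable_snd (hnu : MemP1 nu) (hpi : IsMC mu nu pi) :
    Integrable (fun p : ℝ × ℝ => p.2) pi := by
  have h := hnu.2.2
  rw [← hpi.2.2.2.1] at h
  exact h.comp_measurable measurable_snd

lemma setIntegral_snd (hmu : MemP1 mu) (hnu : MemP1 nu) (hpi : IsMC mu nu pi)
    {s : Set ℝ} (hs : MeasurableSet s) :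
    ∫ p in Prod.fst ⁻¹' s, p.2 ∂pi = ∫ p in Prod.fst ⁻¹' s, p.1 ∂pi := by
  have h := hpi.2.2.2.2 (s.indicator 1) (measurable_one.indicator hs)
    ⟨1, fun x => by by_cases hx : x ∈ s <;> simp [hx]⟩
  have he : (fun p : ℝ × ℝ => s.indicator (1 : ℝ → ℝ) p.1 * (p.2 - p.1)) =
      (Prod.fst ⁻¹' s).indicator fun p => p.2 - p.1 := by
    ext p
    by_cases hp : p.1 ∈ s <;> simp [hp]
  rw [he, integral_indicator (measurable_fst hs),
    integral_sub (hpi.integrable_snd hnu).integrableOn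
      (hpi.integrable_fst hmu).integrableOn] at h
  linarith

lemma integral_snd (hmu : MemP1 mu) (hnu : MemP1 nu) (hpi : IsMC mu nu pi) :
    ∫ p, p.2 ∂pi = bary mu := by
  have h := hpi.setIntegral_snd hmu hnu MeasurableSet.univ
  simp only [preimage_univ, Measure.restrict_univ] at h
  rw [h, bary, ← hpi.2.2.1, integral_map measurable_fst.aemeasurable (by fun_prop)]

lemma setLIntegral_snd (hmu : MemP1 mu) (hnu : MemP1 nu) (hpi : IsMC mu nu pi)
    {s : Set ℝ} (hs : MeasurableSet s) :
    ∫⁻ p in Prod.fst ⁻¹' s, ENNReal.ofReal p.2 ∂pi =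
      ∫⁻ p in Prod.fst ⁻¹' s, ENNReal.ofReal p.1 ∂pi := by
  rw [← ofReal_integral_eq_lintegral_ofReal (hpi.integrable_snd hnu).integrableOn
      (ae_restrict_of_ae (hpi.ae_pos.mono fun _ hp => hp.2.le)),
    ← ofReal_integral_eq_lintegral_ofReal (hpi.integrable_fst hmu).integrableOn
      (ae_restrict_of_ae (hpi.ae_pos.mono fun _ hp => hp.1.le)),
    hpi.setIntegral_snd hmu hnu hs]

lemma ae_lintegral_kernel (hmu : MemP1 mu) (hnu : MemP1 nu) (hpi : IsMC mu nu pi)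
    (k : Kernel ℝ ℝ) [IsMarkovKernel k] (hk : mu ⊗ₘ k = pi) :
    ∀ᵐ x ∂mu, ∫⁻ z, ENNReal.ofReal z ∂(k x) = ENNReal.ofReal x := by
  have := hmu.1
  refine ae_eq_of_forall_setLIntegral_eq_of_sigmaFinite
    (Measurable.lintegral_kernel (by fun_prop)) (by fun_prop) fun s hs _ => ?_
  have h := hpi.setLIntegral_snd hmu hnu hs
  have hs' : MeasurableSet (Prod.fst ⁻¹' s : Set (ℝ × ℝ)) := measurable_fst hs
  rw [← prod_univ, ← hk, Measure.setLIntegral_compProd (by fun_prop) hs MeasurableSet.univ,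
    Measure.setLIntegral_compProd (by fun_prop) hs MeasurableSet.univ] at h
  simpa using h

end IsMC

lemma S_eq_of_lintegral_eq {m : Measure ℝ} {x : ℝ} (hx : 0 < x) (hm : ∀ᵐ z ∂m, 0 < z)
    (h : ∫⁻ z, ENNReal.ofReal z ∂m = ENNReal.ofReal x) :
    S m = (m.withDensity fun z => ENNReal.ofReal x⁻¹ * ENNReal.ofReal z).map
      fun z => z⁻¹ := by
  have hb : bary m = x := by
    rw [bary, integral_eq_lintegral_of_nonneg_ae (hm.mono fun _ hz => hz.le) (by fun_prop), h,
      ENNReal.toReal_ofReal hx.le]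
  have hd : (fun z : ℝ => ENNReal.ofReal x⁻¹ * ENNReal.ofReal z) =
      ENNReal.ofReal x⁻¹ • fun z : ℝ => ENNReal.ofReal z := rfl
  rw [S, hb, hd, withDensity_smul _ (by fun_prop), Measure.map_smul, ENNReal.ofReal_inv_of_pos hx]

/-- Points at which the kernel `k` has the martingale property. -/
def martingalePoints (k : Kernel ℝ ℝ) : Set ℝ :=
  {x | 0 < x ∧ ∫⁻ z, ENNReal.ofReal z ∂(k x) = ENNReal.ofReal x}

lemma measurableSet_martingalePoints (k : Kernel ℝ ℝ) : MeasurableSet (martingalePoints k) :=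
  measurableSet_Ioi.inter (measurableSet_eq_fun
    (Measurable.lintegral_kernel (by fun_prop)) (by fun_prop))

open scoped Classical in
/-- The density `z / x` of the change of numeraire, set to `1` where `k` does not have the
martingale property. -/
noncomputable def numeraireDensity (k : Kernel ℝ ℝ) (x z : ℝ) : ℝ≥0∞ :=
  if x ∈ martingalePoints k then ENNReal.ofReal x⁻¹ * ENNReal.ofReal z else 1

lemma measurable_numeraireDensity (k : Kernel ℝ ℝ) :
    Measurable (Function.uncurry (numeraireDensity k)) := by
  classical
  exact Measurable.ite (measurable_fst (measurableSet_martingalePoints k)) (by fun_prop)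
    measurable_const

/-- The kernel `y ↦ S (k y⁻¹)`, made Markov everywhere. -/
noncomputable def numeraireKernel (k : Kernel ℝ ℝ) [IsSFiniteKernel k] : Kernel ℝ ℝ :=
  ((k.withDensity (numeraireDensity k)).comap (fun y => y⁻¹) measurable_inv).map fun z => z⁻¹

lemma numeraireKernel_apply (k : Kernel ℝ ℝ) [IsSFiniteKernel k] (y : ℝ) :
    numeraireKernel k y =
      ((k y⁻¹).withDensity (numeraireDensity k y⁻¹)).map fun z => z⁻¹ := by
  rw [numeraireKernel, Kernel.map_apply _ measurable_inv, Kernel.comap_apply,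
    Kernel.withDensity_apply _ (measurable_numeraireDensity k)]

lemma lintegral_numeraireKernel (k : Kernel ℝ ℝ) [IsSFiniteKernel k] (y : ℝ) {g : ℝ → ℝ≥0∞}
    (hg : Measurable g) :
    ∫⁻ w, g w ∂(numeraireKernel k y) =
      ∫⁻ z, numeraireDensity k y⁻¹ z * g z⁻¹ ∂(k y⁻¹) := by
  rw [numeraireKernel_apply, lintegral_map hg measurable_inv,
    lintegral_withDensity_eq_lintegral_mul _
      ((measurable_numeraireDensity k).of_uncurry_left) (by fun_prop)]
  rfl

instance (k : Kernel ℝ ℝ) [IsMarkovKernel k] : IsMarkovKernel (numeraireKernel k) := by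
  refine ⟨fun y => ⟨?_⟩⟩
  have h := lintegral_numeraireKernel k y (g := fun _ => 1) measurable_const
  simp only [lintegral_one, mul_one] at h
  rw [h]
  by_cases hy : y⁻¹ ∈ martingalePoints k
  · simp only [numeraireDensity, if_pos hy]
    rw [lintegral_const_mul _ (by fun_prop), hy.2, ENNReal.ofReal_inv_of_pos hy.1]
    exact ENNReal.inv_mul_cancel (by simpa using hy.1) ENNReal.ofReal_ne_top
  · simp [numeraireDensity, if_neg hy]

lemma IsMC.S2_eq_compProd {mu nu : Measure ℝ} {pi : Measure (ℝ × ℝ)} (hmu : MemP1 mu)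
    (hnu : MemP1 nu) (hpi : IsMC mu nu pi) (k : Kernel ℝ ℝ) [IsMarkovKernel k]
    (hk : mu ⊗ₘ k = pi) : S2 pi = S mu ⊗ₘ numeraireKernel k := by
  have := hmu.1
  have := hmu.isProbabilityMeasure_S
  refine Measure.ext_of_lintegral _ fun g hg => ?_
  rw [lintegral_S2 pi hg, hpi.integral_snd hmu hnu, Measure.lintegral_compProd hg,
    lintegral_S mu hg.lintegral_kernel_prod_right', ← hk,
    Measure.lintegral_compProd (by fun_prop)]
  congr 1
  refine lintegral_congr_ae ?_
  filter_upwards [hmu.ae_pos, hpi.ae_lintegral_kernel hmu hnu k hk] with x hx hxk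
  have hxm : x ∈ martingalePoints k := ⟨hx, hxk⟩
  rw [lintegral_numeraireKernel k x⁻¹ (g := fun w => g (x⁻¹, w)) (by fun_prop), inv_inv]
  simp only [numeraireDensity, if_pos hxm, mul_assoc]
  rw [lintegral_const_mul _ (by fun_prop), ← mul_assoc, ← ENNReal.ofReal_mul hx.le,
    mul_inv_cancel₀ hx.ne', ENNReal.ofReal_one, one_mul]

/-- the disintegration of `S(π)` over `S(μ)` satisfies
`(S(π))_{y₀} = S(π_{1/y₀})` for `S(μ)`-a.e. `y₀`. -/
theorem stmt6 (mu nu : Measure ℝ) (hmu : MemP1 mu) (hnu : MemP1 nu)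
    (pi : Measure (ℝ × ℝ)) (hpi : IsMC mu nu pi) :
    ∀ᵐ y0 ∂(S mu), disint (S2 pi) y0 = S (disint pi y0⁻¹) := by
  have := hmu.1
  have := hpi.1
  have := hmu.isProbabilityMeasure_S
  have hk : mu ⊗ₘ pi.condKernel = pi := by
    conv_rhs => rw [← pi.disintegrate pi.condKernel, hpi.fst_eq]
  have hS2 := hpi.S2_eq_compProd hmu hnu pi.condKernel hk
  have hfin : IsFiniteMeasure (S2 pi) := by rw [hS2]; infer_instance
  have hfst : (S2 pi).fst = S mu := by rw [hS2, Measure.fst_compProd]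
  have hcond := eq_condKernel_of_measure_eq_compProd (ρ := S2 pi)
    (numeraireKernel pi.condKernel) (by rw [hfst, ← hS2])
  rw [hfst] at hcond
  have hpos : ∀ᵐ x ∂mu, ∀ᵐ z ∂(pi.condKernel x), 0 < z := by
    refine Measure.ae_ae_of_ae_compProd (p := fun p : ℝ × ℝ => 0 < p.2) ?_
    rw [hk]
    exact hpi.ae_pos.mono fun _ hp => hp.2
  have hS : ∀ᵐ y ∂(S mu), numeraireKernel pi.condKernel y = S (pi.condKernel y⁻¹) := by
    refine ae_S_of_ae_inv ?_
    filter_upwards [hmu.ae_pos, hpi.ae_lintegral_kernel hmu hnu _ hk, hpos] with x hx hxk hxz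
    have hxm : x ∈ martingalePoints pi.condKernel := ⟨hx, hxk⟩
    rw [numeraireKernel_apply, inv_inv, S_eq_of_lintegral_eq hx hxz hxk]
    congr 2
    ext z
    simp only [numeraireDensity, if_pos hxm]
  filter_upwards [hcond, hS] with y hy hy'
  rw [disint, disint, dif_pos hfin, dif_pos (inferInstance : IsFiniteMeasure pi)]
  exact hy.symm.trans hy'
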